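/- If S ⊆ ℤ is dense in the Bohr topology of ℤ and 0 ≤ δ < 1/2, then there is a subset S′ ⊆ S which is dense in the Bohr topology of ℤ and δ-nonrecurrent. -/

import Mathlib

open MeasureTheory Filter Pointwise

/-- Upper Banach density of a set of integers:
`d*(A) = limsup_{n→∞} sup_{k∈ℤ} |A ∩ {k+1,…,k+n}| / n`. -/
noncomputable def upperBanachDensity (A : Set ℤ) : ℝ :=
  Filter.atTop.limsup fun n : ℕ =>
    ⨆ k : ℤ, (Nat.card ↥(A ∩ Set.Ioc k (k + n)) : ℝ) / n

/-- The Bohr topology on ℤ: the weakest topology making every group homomorphism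
from ℤ to 𝕋 = ℝ/ℤ continuous. -/
noncomputable def bohrTopology : TopologicalSpace ℤ :=
  ⨅ φ : ℤ →+ AddCircle (1 : ℝ), TopologicalSpace.induced (⇑φ) inferInstance

/-- A set of integers is Bohr dense if it is dense in the Bohr topology of ℤ. -/
def BohrDense (S : Set ℤ) : Prop := @Dense ℤ bohrTopology S

/-- A set `S ⊆ ℤ` is `δ`-nonrecurrent if there is `A ⊆ ℤ` with upper Banach density
`d*(A) > δ` such that `(A - A) ∩ S = ∅`. -/
def Nonrecurrent (δ : ℝ) (S : Set ℤ) : Prop :=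
  ∃ A : Set ℤ, δ < upperBanachDensity A ∧ (A - A) ∩ S = ∅


abbrev TT := AddCircle (1 : ℝ)

noncomputable def cc (x : TT) : ℂ := Circle.coeHom (AddCircle.toCircle x)

lemma cc_zero : cc 0 = 1 := by simp [cc]
lemma cc_add (x y : TT) : cc (x + y) = cc x * cc y := by
  simp only [cc, AddCircle.toCircle_add, map_mul]
lemma cc_nsmul (x : TT) (n : ℕ) : cc (n • x) = cc x ^ n := by
  simp only [cc, AddCircle.toCircle_nsmul, map_pow]
lemma cc_norm (x : TT) : ‖cc x‖ = 1 :=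
  Circle.norm_coe (AddCircle.toCircle x)
lemma cc_conj (x : TT) : (starRingEnd ℂ) (cc x) = cc (-x) := by
  have h1 : cc x * cc (-x) = 1 := by rw [← cc_add]; simp [cc_zero]
  have h2 : cc x * (starRingEnd ℂ) (cc x) = 1 := by
    rw [Complex.mul_conj', cc_norm]; simp
  have h3 : cc x ≠ 0 := fun h => by simp [h] at h1
  exact mul_left_cancel₀ h3 (h2.trans h1.symm)
lemma cc_sum {κ : Type*} (s : Finset κ) (g : κ → TT) : cc (∑ x ∈ s, g x) = ∏ x ∈ s, cc (g x) := by
  classical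
  induction s using Finset.induction_on with
  | empty => simp [cc_zero]
  | insert a s ha ih => rw [Finset.sum_insert ha, Finset.prod_insert ha, cc_add, ih]
lemma cc_eq_one {x : TT} (h : cc x = 1) : x = 0 := by
  apply AddCircle.injective_toCircle (T := (1:ℝ)) one_ne_zero
  rw [AddCircle.toCircle_zero]
  exact Circle.ext h

lemma mean_lim (x : TT) : Tendsto (fun T : ℕ => (1 / (T : ℂ)) * ∑ n ∈ Finset.range T,
    cc (n • x)) atTop (nhds (if x = 0 then 1 else 0)) := by
  by_cases hx : x = 0
  · subst hx
    simp only [smul_zero, cc_zero, Finset.sum_const,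
      Finset.card_range, if_true]
    refine tendsto_const_nhds.congr' ?_
    filter_upwards [eventually_gt_atTop 0] with T hT
    have : (T : ℂ) ≠ 0 := by exact_mod_cast hT.ne'
    simp [this]
  · simp only [hx, if_false]
    set z : ℂ := cc x with hz
    have hz1 : z ≠ 1 := by
      intro h
      exact hx (cc_eq_one h)
    have hn : ‖z‖ = 1 := by simp [hz, cc_norm]
    have hd : 0 < ‖z - 1‖ := by simpa [sub_eq_zero] using hz1
    rw [tendsto_zero_iff_norm_tendsto_zero]
    have h2 : Tendsto (fun T : ℕ => (2 / ‖z - 1‖) * (1 / (T : ℝ))) atTop (nhds 0) := by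
      simpa using (tendsto_one_div_atTop_nhds_zero_nat (𝕜 := ℝ)).const_mul (2 / ‖z - 1‖)
    refine squeeze_zero (fun _ => norm_nonneg _) (fun T => ?_) h2
    have : ∑ n ∈ Finset.range T, cc (n • x)
        = (z ^ T - 1) / (z - 1) := by
      rw [← geom_sum_eq hz1]
      refine Finset.sum_congr rfl fun n _ => ?_
      rw [cc_nsmul]
    rw [this, norm_mul, mul_comm]
    have h3 : ‖z ^ T - 1‖ ≤ 2 := by
      calc ‖z ^ T - 1‖ ≤ ‖z ^ T‖ + ‖(1:ℂ)‖ := norm_sub_le _ _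
        _ = 2 := by simp [hn]; norm_num
    have h4 : ‖1 / (T:ℂ)‖ = 1 / (T:ℝ) := by simp
    rw [h4, norm_div]
    gcongr

lemma energy {κ : Type*} (K : Finset κ) (m : κ → ℝ) (hm : ∀ k, 0 ≤ m k) (v : κ → TT)
    (ψ : TT →+ TT) (B : ℝ)
    (h : ∀ n : ℕ, ‖∑ k ∈ K, (m k : ℂ) *
      cc (n • v k - ψ (v k))‖ ^ 2 ≤ B) :
    ∑ k ∈ K, m k ^ 2 ≤ B := by
  classical
  have key : ∀ n : ℕ, ((‖∑ k ∈ K, (m k : ℂ) *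
      cc (n • v k - ψ (v k))‖ ^ 2 : ℝ) : ℂ) =
      ∑ k ∈ K, ∑ l ∈ K, (m k : ℂ) * (m l : ℂ) *
        cc (-ψ (v k - v l)) *
        cc (n • (v k - v l)) := by
    intro n
    rw [Complex.ofReal_pow, ← Complex.mul_conj', map_sum, Finset.sum_mul_sum]
    refine Finset.sum_congr rfl fun k _ => Finset.sum_congr rfl fun l _ => ?_
    rw [map_mul, Complex.conj_ofReal, cc_conj]
    have : n • v k - ψ (v k) + -(n • v l - ψ (v l)) = -ψ (v k - v l) + n • (v k - v l) := by
      rw [map_sub, smul_sub]; abel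
    have h2 := congrArg cc this
    rw [cc_add, cc_add] at h2
    linear_combination (m k : ℂ) * m l * h2
  have hl : Tendsto (fun T : ℕ => ∑ k ∈ K, ∑ l ∈ K, (m k : ℂ) * (m l : ℂ) *
        cc (-ψ (v k - v l)) *
        ((1 / (T : ℂ)) * ∑ n ∈ Finset.range T,
          cc (n • (v k - v l)))) atTop
      (nhds (∑ k ∈ K, ∑ l ∈ K, (m k : ℂ) * (m l : ℂ) *
        cc (-ψ (v k - v l)) *
        (if v k - v l = 0 then 1 else 0))) :=
    tendsto_finsetSum _ fun k _ => tendsto_finsetSum _ fun l _ => (mean_lim _).const_mul _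
  have e1 : (∑ k ∈ K, ∑ l ∈ K, (m k : ℂ) * (m l : ℂ) *
        cc (-ψ (v k - v l)) *
        (if v k - v l = 0 then 1 else 0)) =
      ((∑ k ∈ K, ∑ l ∈ K, (if v k - v l = 0 then m k * m l else 0) : ℝ) : ℂ) := by
    push_cast
    refine Finset.sum_congr rfl fun k _ => Finset.sum_congr rfl fun l _ => ?_
    split_ifs with h
    · rw [h]; simp [cc_zero]
    · simp
  have e2 : ∀ T : ℕ, (∑ k ∈ K, ∑ l ∈ K, (m k : ℂ) * (m l : ℂ) *
        cc (-ψ (v k - v l)) *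
        ((1 / (T : ℂ)) * ∑ n ∈ Finset.range T,
          cc (n • (v k - v l)))) =
      (((1 / (T : ℝ)) * ∑ n ∈ Finset.range T, ‖∑ k ∈ K, (m k : ℂ) *
      cc (n • v k - ψ (v k))‖ ^ 2 : ℝ) : ℂ) := by
    intro T
    rw [Complex.ofReal_mul, Complex.ofReal_sum, Finset.sum_congr rfl (fun n _ => key n)]
    push_cast
    have c1 : ∑ n ∈ Finset.range T, ∑ k ∈ K, ∑ l ∈ K, (m k : ℂ) * (m l : ℂ) *
        cc (-ψ (v k - v l)) * cc (n • (v k - v l)) = ∑ k ∈ K, ∑ l ∈ K, ∑ n ∈ Finset.range T,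
        (m k : ℂ) * (m l : ℂ) * cc (-ψ (v k - v l)) * cc (n • (v k - v l)) := by
      rw [Finset.sum_comm]
      exact Finset.sum_congr rfl fun k _ => Finset.sum_comm
    rw [c1, Finset.mul_sum]
    refine Finset.sum_congr rfl fun k _ => ?_
    rw [Finset.mul_sum]
    refine Finset.sum_congr rfl fun l _ => ?_
    rw [← Finset.mul_sum]
    ring
  rw [e1] at hl
  simp_rw [e2] at hl
  have hr := (Complex.continuous_re.tendsto _).comp hl
  simp only [Function.comp_def, Complex.ofReal_re] at hr
  have hle : ∑ k ∈ K, ∑ l ∈ K, (if v k - v l = 0 then m k * m l else 0) ≤ B := by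
    refine le_of_tendsto hr ?_
    filter_upwards [eventually_gt_atTop 0] with T hT
    have hT' : (0:ℝ) < T := by exact_mod_cast hT
    rw [one_div, inv_mul_le_iff₀ hT']
    calc _ ≤ ∑ n ∈ Finset.range T, B := Finset.sum_le_sum fun n _ => h n
      _ = T * B := by simp
  refine le_trans (Finset.sum_le_sum fun k hk => ?_) hle
  calc m k ^ 2 = (if v k - v k = 0 then m k * m k else 0) := by simp [sq]
    _ ≤ _ := Finset.single_le_sum (f := fun l => if v k - v l = 0 then m k * m l else 0)
      (fun l _ => by
        split_ifs
        · exact mul_nonneg (hm _) (hm _)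
        · exact le_rfl) hk

lemma kron_sup (ψ : TT →+ TT) (J : Finset TT) (hJ : J.Nonempty) (C : ℝ) (hC : C < J.card) :
    ∃ n : ℕ, C < ‖∑ x ∈ J, cc (n • x - ψ x)‖ := by
  classical
  by_contra! hcon
  have hC0 : 0 ≤ C := (norm_nonneg _).trans (hcon 0)
  have hJ0 : (0:ℝ) < J.card := by exact_mod_cast hJ.card_pos
  -- enlarge C to be positive
  obtain ⟨D, hCD, hDJ⟩ := exists_between hC
  have hD0 : 0 < D := hC0.trans_lt hCD
  have main : ∀ p : ℕ, ((J.card : ℝ) ^ p) ^ 2 ≤ ((p + 1 : ℕ) : ℝ) ^ J.card * (D ^ p) ^ 2 := by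
    intro p
    have h1 := energy (J.piAntidiag p) (fun k => (Nat.multinomial J k : ℝ)) (fun k => by positivity)
      (fun k => ∑ x ∈ J, k x • x) ψ ((D ^ p) ^ 2) (fun n => by
        have : ∑ k ∈ J.piAntidiag p, (((Nat.multinomial J k : ℝ)) : ℂ) *
            cc (n • (∑ x ∈ J, k x • x) - ψ (∑ x ∈ J, k x • x))
            = (∑ x ∈ J, cc (n • x - ψ x)) ^ p := by
          rw [Finset.sum_pow_eq_sum_piAntidiag]
          refine Finset.sum_congr rfl fun k _ => ?_
          congr 1
          have e : n • (∑ x ∈ J, k x • x) - ψ (∑ x ∈ J, k x • x)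
              = ∑ x ∈ J, k x • (n • x - ψ x) := by
            rw [map_sum, Finset.smul_sum, ← Finset.sum_sub_distrib]
            refine Finset.sum_congr rfl fun x _ => ?_
            rw [map_nsmul, smul_sub, smul_comm]
          rw [e]
          rw [cc_sum]
          exact Finset.prod_congr rfl fun x _ => cc_nsmul _ _
        rw [this, norm_pow]
        have := (hcon n).trans hCD.le
        gcongr)
    have h2 := sq_sum_le_card_mul_sum_sq (s := J.piAntidiag p)
      (f := fun k => (Nat.multinomial J k : ℝ))
    have h3 : ∑ k ∈ J.piAntidiag p, (Nat.multinomial J k : ℝ) = (J.card : ℝ) ^ p := by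
      have := Finset.sum_pow_eq_sum_piAntidiag J (fun _ => (1:ℝ)) p
      simpa using this.symm
    have h4 : (J.piAntidiag p).card ≤ (p + 1) ^ J.card := by
      have hinj : (J.piAntidiag p).card ≤ (J.pi (fun _ => Finset.range (p+1))).card := by
        refine Finset.card_le_card_of_injOn (fun k x _ => k x) ?_ ?_
        · intro k hk
          simp only [Finset.mem_coe, Finset.mem_piAntidiag] at hk
          simp only [Finset.mem_coe, Finset.mem_pi, Finset.mem_range]
          intro a ha
          have := Finset.single_le_sum (f := k) (fun _ _ => Nat.zero_le _) ha
          have h2 := hk.1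
          exact Nat.lt_succ_of_le (h2 ▸ this)
        · intro k hk l hl hkl
          simp only [Finset.mem_coe, Finset.mem_piAntidiag] at hk hl
          funext x
          by_cases hx : x ∈ J
          · exact congrFun (congrFun hkl x) hx
          · have a1 : k x = 0 := by by_contra h; exact hx (hk.2 x h)
            have a2 : l x = 0 := by by_contra h; exact hx (hl.2 x h)
            rw [a1, a2]
      simpa using hinj
    rw [h3] at h2
    refine h2.trans ?_
    have h4' : ((J.piAntidiag p).card : ℝ) ≤ ((p + 1 : ℕ) : ℝ) ^ J.card := by exact_mod_cast h4
    gcongr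
  set R : ℝ := (J.card / D) ^ 2 with hR
  have hR1 : 1 < R := by
    rw [hR]; apply one_lt_pow₀ _ two_ne_zero
    rwa [one_lt_div hD0]
  have hlim := (tendsto_pow_const_div_const_pow_of_one_lt J.card hR1).comp (tendsto_add_atTop_nat 1)
  have hRpos : 0 < R := by linarith
  obtain ⟨p, hp⟩ := (hlim.eventually (gt_mem_nhds (show (0:ℝ) < 1 / R by positivity))).exists
  simp only [Function.comp_def] at hp
  have hm := main p
  rw [div_lt_div_iff₀ (by positivity) hRpos, pow_succ R p, one_mul] at hp
  have h5 : ((p + 1 : ℕ) : ℝ) ^ J.card < R ^ p := lt_of_mul_lt_mul_right hp hRpos.le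
  have h6 : R ^ p * (D ^ p) ^ 2 = ((J.card : ℝ) ^ p) ^ 2 := by
    rw [hR, div_pow, div_pow]; field_simp; ring
  have : ((p + 1 : ℕ) : ℝ) ^ J.card * (D ^ p) ^ 2 < R ^ p * (D ^ p) ^ 2 := by
    gcongr
  linarith

lemma kron (ψ : TT →+ TT) (F : Finset TT) (ε : ℝ) (hε : 0 < ε) :
    ∃ n : ℤ, ∀ x ∈ F, ‖n • x - ψ x‖ < ε := by
  classical
  obtain ⟨η, hη, hη'⟩ : ∃ η > 0, ∀ x : TT, ‖cc x - 1‖ < η → ‖x‖ < ε := by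
    have hc := (AddCircle.homeomorphCircle (T := (1:ℝ)) one_ne_zero).symm.continuous.continuousAt
      (x := (1 : Circle))
    rw [Metric.continuousAt_iff] at hc
    obtain ⟨η, hη, h⟩ := hc ε hε
    refine ⟨η, hη, fun x hx => ?_⟩
    have h1 := h (x := AddCircle.toCircle x) (by
      rw [← dist_eq_norm] at hx; exact hx)
    have e1 : (AddCircle.homeomorphCircle (T := (1:ℝ)) one_ne_zero).symm (AddCircle.toCircle x) = x := by
      rw [Homeomorph.symm_apply_eq, AddCircle.homeomorphCircle_apply]
    have e2 : (AddCircle.homeomorphCircle (T := (1:ℝ)) one_ne_zero).symm 1 = 0 := by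
      rw [Homeomorph.symm_apply_eq, AddCircle.homeomorphCircle_apply, AddCircle.toCircle_zero]
    rw [e1, e2, dist_zero_right] at h1
    exact h1
  set J := insert (0:TT) F with hJ
  obtain ⟨n, hn⟩ := kron_sup ψ J ⟨0, by simp [hJ]⟩ (J.card - η ^ 2 / 4) (by
    have : 0 < η^2/4 := by positivity
    linarith)
  refine ⟨n, fun x hx => hη' _ ?_⟩
  simp only [natCast_zsmul]
  by_cases hx0 : x = 0
  · subst hx0; simpa [cc_zero] using hη
  set u : TT → ℂ := fun x => cc (n • x - ψ x) with hu
  have hu0 : u 0 = 1 := by simp [hu, cc_zero]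
  have hun : ∀ x, ‖u x‖ = 1 := fun x => cc_norm _
  have hxJ : x ∈ J.erase 0 := by simp [hJ, hx0, hx]
  have h0J : (0:TT) ∈ J := by simp [hJ]
  have hs : ∑ x ∈ J, u x = (1 + u x) + ∑ y ∈ (J.erase 0).erase x, u y := by
    rw [← Finset.add_sum_erase J u h0J, ← Finset.add_sum_erase (J.erase 0) u hxJ, hu0]; ring
  have hb : ‖∑ y ∈ (J.erase 0).erase x, u y‖ ≤ (J.card : ℝ) - 2 := by
    refine (norm_sum_le _ _).trans ?_
    simp only [hun, Finset.sum_const, nsmul_eq_mul, mul_one]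
    have c1 := Finset.card_erase_add_one h0J
    have c2 := Finset.card_erase_add_one hxJ
    have : (((J.erase 0).erase x).card : ℝ) + 1 + 1 = J.card := by exact_mod_cast (by omega)
    linarith
  have h1 : 2 - η ^ 2 / 4 < ‖1 + u x‖ := by
    have := norm_add_le (1 + u x) (∑ y ∈ (J.erase 0).erase x, u y)
    rw [← hs] at this
    linarith
  have hpar := parallelogram_law_with_norm ℝ (u x) (1:ℂ)
  rw [hun, norm_one, add_comm (u x) 1] at hpar
  have h2 : ‖1 + u x‖ ≤ 2 := by
    refine (norm_add_le _ _).trans ?_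
    rw [hun]; norm_num
  have h3 : ‖u x - 1‖ ^ 2 < η ^ 2 := by
    by_cases h : 2 - η ^ 2 / 4 < 0
    · nlinarith [norm_nonneg (1 + u x)]
    · nlinarith [norm_nonneg (1 + u x)]
  exact lt_of_pow_lt_pow_left₀ 2 hη.le h3

lemma bohr_cont (x : TT) : @Continuous ℤ TT bohrTopology _ (fun n : ℤ => n • x) := by
  have h : @Continuous ℤ TT bohrTopology _ (⇑((zmultiplesHom TT) x)) :=
    continuous_iff_le_induced.2 (iInf_le (fun φ : ℤ →+ AddCircle (1 : ℝ) =>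
      TopologicalSpace.induced (⇑φ) inferInstance) ((zmultiplesHom TT) x))
  exact h

lemma exists_psi {r k : ℕ} (β : Fin r → ℝ)
    (hβ : LinearIndependent ℚ (fun o : Option (Fin r) => o.elim (1:ℝ) β))
    (θ : Fin k → TT) (m : ℤ) (g : ℝ) :
    ∃ (ψ : TT →+ TT) (I : Finset (Fin r)), (∀ j, ψ (θ j) = m • θ j) ∧
      (∀ i ∈ I, ψ (β i : TT) = (g : TT)) ∧ r ≤ I.card + k := by
  classical
  choose t ht using fun j => QuotientAddGroup.mk_surjective (s := AddSubgroup.zmultiples (1:ℝ)) (θ j)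
  set e : Option (Fin k) → ℝ := fun o => o.elim (1:ℝ) t with he
  set V : Submodule ℚ ℝ := Submodule.span ℚ (Set.range e) with hV
  have h1V : (1:ℝ) ∈ V := Submodule.subset_span ⟨none, rfl⟩
  have htV : ∀ j, t j ∈ V := fun j => Submodule.subset_span ⟨some j, rfl⟩
  obtain ⟨κ, a, ha, hspan, hli⟩ := exists_linearIndependent' ℚ (fun i => V.mkQ (β i))
  have : Finite κ := Finite.of_injective a ha
  have : Fintype κ := Fintype.ofFinite κ
  obtain ⟨L0, hL0⟩ := LinearMap.exists_extend
    ((Module.Basis.span hli).constr ℚ (fun j => g - m * β (a j)))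
  have hL0' : ∀ j, L0 (V.mkQ (β (a j))) = g - m * β (a j) := by
    intro j
    have h1 := LinearMap.congr_fun hL0 (Module.Basis.span hli j)
    rw [Module.Basis.constr_basis] at h1
    rw [← h1, LinearMap.comp_apply, Submodule.subtype_apply, Module.Basis.span_apply]
    rfl
  have hL0V : ∀ x ∈ V, L0 (V.mkQ x) = 0 := by
    intro x hx
    have : V.mkQ x = 0 := by simpa using hx
    rw [this, map_zero]
  let f : ℝ →+ TT :=
    { toFun := fun x => ((m * x + L0 (V.mkQ x) : ℝ) : TT)
      map_zero' := by simp
      map_add' := fun x y => by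
        rw [← AddCircle.coe_add, map_add, map_add]; congr 1; ring }
  have hf : ∀ x, f x = ((m * x + L0 (V.mkQ x) : ℝ) : TT) := fun _ => rfl
  have hf1 : AddSubgroup.zmultiples (1:ℝ) ≤ f.ker := by
    rw [AddSubgroup.zmultiples_le]
    rw [AddMonoidHom.mem_ker, hf, hL0V 1 h1V]
    rw [AddCircle.coe_eq_zero_iff]
    exact ⟨m, by simp⟩
  refine ⟨QuotientAddGroup.lift _ f hf1, Finset.univ.image a, ?_, ?_, ?_⟩
  · intro j
    rw [← ht j]
    change f (t j) = _
    rw [hf, hL0V _ (htV j), add_zero]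
    change _ = m • ((t j : ℝ) : TT)
    rw [← AddCircle.coe_zsmul]; simp
  · intro i hi
    obtain ⟨j, -, rfl⟩ := Finset.mem_image.1 hi
    change f (β (a j)) = _
    rw [hf, hL0']
    congr 1; ring
  · rw [Finset.card_image_of_injective _ ha, Finset.card_univ]
    have hle : Submodule.span ℚ (Set.range (fun o : Option (Fin r) => o.elim (1:ℝ) β)) ≤
        Submodule.span ℚ (Set.range (β ∘ a)) ⊔ V := by
      rw [Submodule.span_le]
      rintro _ ⟨o, rfl⟩
      rcases o with _ | i
      · exact Submodule.mem_sup_right h1V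
      · have h1 : V.mkQ (β i) ∈ Submodule.span ℚ (Set.range ((fun i => V.mkQ (β i)) ∘ a)) := by
          rw [hspan]; exact Submodule.subset_span ⟨i, rfl⟩
        have h2 : Set.range ((fun i => V.mkQ (β i)) ∘ a) = V.mkQ '' (Set.range (β ∘ a)) := by
          rw [← Set.range_comp]; rfl
        rw [h2, ← Submodule.map_span, ← Submodule.mem_comap, Submodule.comap_map_mkQ, sup_comm] at h1
        exact h1
    have hfd1 : FiniteDimensional ℚ (Submodule.span ℚ (Set.range (β ∘ a))) :=
      FiniteDimensional.span_of_finite ℚ (Set.finite_range _)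
    have hfd2 : FiniteDimensional ℚ V :=
      FiniteDimensional.span_of_finite ℚ (Set.finite_range _)
    have h1 := Submodule.finrank_mono hle
    rw [finrank_span_eq_card hβ] at h1
    have h2 := Submodule.finrank_add_le_finrank_add_finrank (Submodule.span ℚ (Set.range (β ∘ a))) V
    have h3 : Module.finrank ℚ (Submodule.span ℚ (Set.range (β ∘ a))) ≤ _ :=
      finrank_range_le_card (R := ℚ) (β ∘ a)
    have h4 : Module.finrank ℚ V ≤ _ := finrank_range_le_card (R := ℚ) e
    simp only [Fintype.card_option, Fintype.card_fin] at h1 h4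
    omega

lemma exists_mem_S {S : Set ℤ} (hS : BohrDense S) {r k : ℕ} (β : Fin r → ℝ)
    (hβ : LinearIndependent ℚ (fun o : Option (Fin r) => o.elim (1:ℝ) β))
    (θ : Fin k → TT) (m : ℤ) (g : ℝ) (ε₁ ε₂ : ℝ) (h1 : 0 < ε₁) (h2 : 0 < ε₂) :
    ∃ n ∈ S, (∀ j, ‖n • θ j - m • θ j‖ < ε₁) ∧
      ∃ I : Finset (Fin r), (∀ i ∈ I, ‖n • (β i : TT) - (g : TT)‖ < ε₂) ∧ r ≤ I.card + k := by
  classical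
  obtain ⟨ψ, I, hψ, hI, hc⟩ := exists_psi β hβ θ m g
  obtain ⟨n₀, hn₀⟩ := kron ψ (Finset.univ.image θ ∪ Finset.univ.image (fun i => (β i : TT)))
    (min ε₁ ε₂) (lt_min h1 h2)
  letI := bohrTopology
  have ho : IsOpen {n : ℤ | (∀ j, ‖n • θ j - m • θ j‖ < ε₁) ∧
      (∀ i ∈ I, ‖n • (β i : TT) - (g : TT)‖ < ε₂)} := by
    have e : {n : ℤ | (∀ j, ‖n • θ j - m • θ j‖ < ε₁) ∧
      (∀ i ∈ I, ‖n • (β i : TT) - (g : TT)‖ < ε₂)} =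
      (⋂ j, {n : ℤ | ‖n • θ j - m • θ j‖ < ε₁}) ∩
      ⋂ i ∈ I, {n : ℤ | ‖n • (β i : TT) - (g : TT)‖ < ε₂} := by
      ext n; simp
    rw [e]
    refine IsOpen.inter (isOpen_iInter_of_finite fun j => ?_)
      (isOpen_biInter_finset fun i _ => ?_)
    · exact isOpen_lt ((bohr_cont _).sub continuous_const).norm continuous_const
    · exact isOpen_lt ((bohr_cont _).sub continuous_const).norm continuous_const
  obtain ⟨n, hn, hnS⟩ := hS.inter_open_nonempty _ ho ⟨n₀, by
    constructor
    · intro j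
      rw [← hψ j]
      exact (hn₀ _ (by simp)).trans_le (min_le_left _ _)
    · intro i hi
      rw [← hI i hi]
      exact (hn₀ _ (by simp)).trans_le (min_le_right _ _)⟩
  exact ⟨n, hnS, hn.1, I, hn.2, hc⟩

/-- the finite set at one stage -/
lemma exists_finite_S {S : Set ℤ} (hS : BohrDense S) {r k : ℕ} (β : Fin r → ℝ)
    (hβ : LinearIndependent ℚ (fun o : Option (Fin r) => o.elim (1:ℝ) β))
    (m : ℤ) (g : ℝ) (ε₁ ε₂ : ℝ) (h1 : 0 < ε₁) (h2 : 0 < ε₂) :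
    ∃ E : Finset ℤ, (∀ n ∈ E, n ∈ S) ∧ (∀ θ : Fin k → TT, ∃ n ∈ E, ∀ j, ‖n • θ j - m • θ j‖ < ε₁) ∧
      ∀ n ∈ E, ∃ I : Finset (Fin r), (∀ i ∈ I, ‖n • (β i : TT) - (g : TT)‖ < ε₂) ∧ r ≤ I.card + k := by
  classical
  choose n hnS hn hI using fun θ : Fin k → TT => exists_mem_S hS β hβ θ m g ε₁ ε₂ h1 h2
  obtain ⟨t, ht⟩ := isCompact_univ.elim_finite_subcover
    (fun θ : Fin k → TT => {θ' : Fin k → TT | ∀ j, ‖n θ • θ' j - m • θ' j‖ < ε₁})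
    (fun θ => by
      rw [Set.setOf_forall]
      refine isOpen_iInter_of_finite fun j => ?_
      exact isOpen_lt (by fun_prop) continuous_const)
    (fun θ _ => Set.mem_iUnion.2 ⟨θ, hn θ⟩)
  refine ⟨t.image n, ?_, ?_, ?_⟩
  · intro x hx
    obtain ⟨θ, -, rfl⟩ := Finset.mem_image.1 hx
    exact hnS θ
  · intro θ
    have := ht (Set.mem_univ θ)
    simp only [Set.mem_iUnion, Set.mem_setOf_eq] at this
    obtain ⟨θ', h, h'⟩ := this
    exact ⟨n θ', Finset.mem_image_of_mem _ h, h'⟩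
  · intro x hx
    obtain ⟨θ, -, rfl⟩ := Finset.mem_image.1 hx
    exact hI θ


lemma exists_beta (r : ℕ) (N : ℕ) (γ : ℝ) (hγ : 0 < γ) :
    ∃ β : Fin r → ℝ, LinearIndependent ℚ (fun o : Option (Fin r) => o.elim (1:ℝ) β) ∧
      ∀ i, |β i - 1 / N| ≤ γ := by
  classical
  have hx : Transcendental ℚ (liouvilleNumber 2) := by
    have := transcendental_liouvilleNumber (m := 2) le_rfl
    have h2 : Transcendental ℤ (liouvilleNumber 2) := by simpa using this
    intro h
    exact h2 ((IsFractionRing.isAlgebraic_iff ℤ ℚ ℝ).2 h)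
  set x : ℝ := liouvilleNumber 2
  have hli : LinearIndependent ℚ (fun n : ℕ => x ^ n) := by
    have h1 := (Polynomial.basisMonomials ℚ).linearIndependent.map' (Polynomial.aeval x).toLinearMap
      (LinearMap.ker_eq_bot.2 (transcendental_iff_injective.1 hx))
    have h2 : (⇑(Polynomial.aeval x).toLinearMap ∘ ⇑(Polynomial.basisMonomials ℚ))
        = (fun n : ℕ => x ^ n) := by
      funext n
      simp
    rw [h2] at h1
    exact h1
  have hli2 : LinearIndependent ℚ (fun o : Option (Fin r) => x ^ (o.elim 0 (fun i => (i:ℕ) + 1))) := by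
    refine hli.comp (fun o : Option (Fin r) => o.elim 0 (fun i => (i:ℕ) + 1)) ?_
    rintro (_ | i) (_ | j) h
    · rfl
    · simp at h
    · simp at h
    · simp only [Option.elim_some, Nat.add_right_cancel_iff] at h
      rw [Fin.ext h]
  set X : ℝ := ∑ i : Fin r, |x ^ ((i:ℕ)+1)| + 1 with hX
  have hX0 : 0 < X := by positivity
  obtain ⟨q, hq0, hq⟩ := exists_rat_btwn (div_pos hγ hX0)
  have hq0' : (0:ℚ) < q := by exact_mod_cast hq0
  refine ⟨fun i => 1 / N + q * x ^ ((i:ℕ)+1), ?_, ?_⟩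
  · rw [Fintype.linearIndependent_iff] at hli2 ⊢
    intro c hc
    have h1 := hli2 (fun o => o.elim (c none + ∑ i, c (some i) / N) (fun i => c (some i) * q)) (by
      rw [← hc, Fintype.sum_option, Fintype.sum_option]
      simp only [Option.elim_none, Option.elim_some, pow_zero, add_smul, smul_add,
        Finset.sum_add_distrib, Finset.sum_smul, Rat.smul_def]
      push_cast
      simp only [mul_one, div_eq_mul_inv, one_mul]
      simp only [mul_assoc]
      ring)
    have h2 : ∀ i, c (some i) = 0 := fun i => by
      have := h1 (some i)
      simpa [hq0'.ne'] using this
    have h3 := h1 none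
    simp only [Option.elim_none, h2, zero_div, Finset.sum_const_zero, add_zero] at h3
    rintro (_ | i)
    · exact h3
    · exact h2 i
  · intro i
    have h1 : |x ^ ((i:ℕ)+1)| ≤ X := by
      have := Finset.single_le_sum (f := fun i : Fin r => |x ^ ((i:ℕ)+1)|) (fun _ _ => abs_nonneg _)
        (Finset.mem_univ i)
      simp only [hX]; linarith
    rw [add_sub_cancel_left, abs_mul, abs_of_pos hq0]
    rw [lt_div_iff₀ hX0] at hq
    calc (q:ℝ) * |x ^ ((i:ℕ)+1)| ≤ q * X := by gcongr
      _ ≤ γ := hq.le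

def xi {α : Type*} [DecidableEq α] (c c' y : α) : ℤ :=
  (if y = c then 1 else 0) - (if y = c' then 1 else 0)

def DD {α : Type*} [DecidableEq α] {r : ℕ} (c c' : α) (x : Fin r → α) : ℤ := ∑ i, xi c c' (x i)

lemma sum_cons' {α : Type*} [Fintype α] {r : ℕ} (F : (Fin (r+1) → α) → ℝ) :
    ∑ x, F x = ∑ x : Fin r → α, ∑ y : α, F (Fin.cons y x : Fin (r+1) → α) := by
  rw [Finset.sum_comm, ← Fintype.sum_prod_type' (f := fun (y : α) (x : Fin r → α) =>
    F (Fin.cons y x : Fin (r+1) → α))]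
  exact (Fintype.sum_equiv (Fin.consEquiv (fun _ : Fin (r+1) => α)) _ _ (fun _ => rfl)).symm

lemma DD_cons {α : Type*} [DecidableEq α] {r : ℕ} (c c' y : α) (x : Fin r → α) :
    DD c c' (Fin.cons y x : Fin (r+1) → α) = DD c c' x + xi c c' y := by
  unfold DD
  rw [Fin.sum_univ_succ]; simp [add_comm]

lemma sum_xi {α : Type*} [DecidableEq α] [Fintype α] (c c' : α) (hc : c ≠ c') (G : ℤ → ℝ) :
    ∑ y : α, G (xi c c' y) = (Fintype.card α : ℝ) * G 0 + (G 1 - G 0) + (G (-1) - G 0) := by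
  have h : ∀ y : α, G (xi c c' y) = G 0 + (if y = c then G 1 - G 0 else 0)
      + (if y = c' then G (-1) - G 0 else 0) := by
    intro y
    unfold xi
    by_cases h1 : y = c
    · have h2 : y ≠ c' := fun h => hc (h1.symm.trans h)
      simp [h1, hc]
    · by_cases h2 : y = c'
      · simp [h2, hc.symm]
      · simp [h1, h2]
  rw [Finset.sum_congr rfl (fun y _ => h y)]
  simp [Finset.sum_add_distrib]

lemma tanaka {α : Type*} [DecidableEq α] [Fintype α] (c c' : α) (hc : c ≠ c') (a : ℤ) (r : ℕ) :
    ∑ x : Fin (r+1) → α, |((DD c c' x - a : ℤ) : ℝ)| =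
      (Fintype.card α : ℝ) * ∑ x : Fin r → α, |((DD c c' x - a : ℤ) : ℝ)| +
      2 * ((Finset.univ.filter (fun x : Fin r → α => DD c c' x = a)).card : ℝ) := by
  rw [sum_cons', Finset.card_filter, Finset.mul_sum]
  push_cast
  rw [Finset.mul_sum, ← Finset.sum_add_distrib]
  refine Finset.sum_congr rfl fun x _ => ?_
  simp only [DD_cons]
  rw [sum_xi c c' hc (fun t => |((DD c c' x + t : ℤ) : ℝ) - a|)]
  set d := DD c c' x
  by_cases h : d = a
  · simp [h]; ring
  · have h' : (|((d + 1 : ℤ) : ℝ) - a|) + |((d + (-1) : ℤ) : ℝ) - a| = 2 * |(d:ℝ) - a| := by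
      rcases lt_or_gt_of_ne h with h1 | h1
      · have : (d:ℝ) + 1 ≤ a := by exact_mod_cast h1
        push_cast
        rw [abs_of_nonpos (by linarith), abs_of_nonpos (by linarith), abs_of_nonpos (by linarith)]
        ring
      · have : (a:ℝ) + 1 ≤ d := by exact_mod_cast h1
        push_cast
        rw [abs_of_nonneg (by linarith), abs_of_nonneg (by linarith), abs_of_nonneg (by linarith)]
        ring
    simp only [h, if_false, add_zero, mul_zero]
    linarith

lemma second {α : Type*} [DecidableEq α] [Fintype α] (c c' : α) (hc : c ≠ c') (r : ℕ) :
    (Fintype.card α : ℝ) * ∑ x : Fin r → α, ((DD c c' x : ℤ) : ℝ) ^ 2 =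
      2 * r * (Fintype.card α : ℝ) ^ r := by
  induction r with
  | zero => simp [DD]
  | succ r ih =>
    have h : ∑ x : Fin (r+1) → α, ((DD c c' x : ℤ) : ℝ) ^ 2 =
      (Fintype.card α : ℝ) * ∑ x : Fin r → α, ((DD c c' x : ℤ) : ℝ) ^ 2 +
        2 * (Fintype.card α : ℝ) ^ r := by
      rw [sum_cons', Finset.mul_sum]
      have : 2 * (Fintype.card α : ℝ) ^ r = ∑ x : Fin r → α, (2:ℝ) := by simp; ring
      rw [this, ← Finset.sum_add_distrib]
      refine Finset.sum_congr rfl fun x _ => ?_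
      simp only [DD_cons]
      rw [sum_xi c c' hc (fun t => ((DD c c' x + t : ℤ) : ℝ) ^ 2)]
      push_cast
      ring
    rw [h, ih]; push_cast; ring

lemma anti {α : Type*} [DecidableEq α] [Fintype α] (c c' : α) (hc : c ≠ c') (a : ℤ) (ε : ℝ)
    (hε : 0 < ε) : ∃ C : ℝ, ∀ R : ℕ, ∑ r ∈ Finset.range R,
      ((Finset.univ.filter (fun x : Fin r → α => DD c c' x = a)).card : ℝ) / (Fintype.card α : ℝ) ^ r
      ≤ ε * R + C := by
  set q : ℝ := (Fintype.card α : ℝ) with hq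
  have hq0 : 0 < q := by
    have : 0 < Fintype.card α := Fintype.card_pos_iff.2 ⟨c⟩
    rw [hq]; exact_mod_cast this
  have tel : ∀ R : ℕ, ∑ r ∈ Finset.range R,
      ((Finset.univ.filter (fun x : Fin r → α => DD c c' x = a)).card : ℝ) / q ^ r
      = (q / 2) * ((∑ x : Fin R → α, |((DD c c' x - a : ℤ) : ℝ)|) / q ^ R - |(a:ℝ)|) := by
    intro R
    induction R with
    | zero => simp [DD]
    | succ R ih =>
      rw [Finset.sum_range_succ, ih, tanaka c c' hc, ← hq, pow_succ]
      field_simp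
      ring
  refine ⟨q / 2 * (1 / (4 * ε)), fun R => ?_⟩
  rw [tel]
  have h1 : ∑ x : Fin R → α, |((DD c c' x - a : ℤ) : ℝ)| ≤
      ε * ∑ x : Fin R → α, ((DD c c' x : ℤ) : ℝ) ^ 2 + (1 / (4 * ε) + |(a:ℝ)|) * q ^ R := by
    have : (1 / (4 * ε) + |(a:ℝ)|) * q ^ R = ∑ x : Fin R → α, (1 / (4 * ε) + |(a:ℝ)|) := by
      simp [hq]; ring
    rw [this, Finset.mul_sum, ← Finset.sum_add_distrib]
    refine Finset.sum_le_sum fun x _ => ?_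
    push_cast
    have h2 : |(DD c c' x : ℝ)| ≤ ε * (DD c c' x : ℝ) ^ 2 + 1 / (4 * ε) := by
      rw [← sq_abs]
      set u := |(DD c c' x : ℝ)|
      have : ε * u ^ 2 + 1 / (4 * ε) - u = (2 * ε * u - 1) ^ 2 / (4 * ε) := by
        field_simp; ring
      have h3 : 0 ≤ (2 * ε * u - 1) ^ 2 / (4 * ε) := by positivity
      linarith
    have h3 := abs_sub (DD c c' x : ℝ) (a:ℝ)
    linarith
  have h2 := second c c' hc R
  rw [← hq] at h2
  have h3 : ∑ x : Fin R → α, ((DD c c' x : ℤ) : ℝ) ^ 2 = 2 * R * q ^ R / q := by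
    rw [← h2]; field_simp
  rw [h3] at h1
  have h4 : (∑ x : Fin R → α, |((DD c c' x - a : ℤ) : ℝ)|) / q ^ R ≤
      ε * (2 * R / q) + (1 / (4 * ε) + |(a:ℝ)|) := by
    rw [div_le_iff₀ (by positivity)]
    refine h1.trans (le_of_eq ?_)
    field_simp
  calc _ ≤ (q / 2) * ((ε * (2 * R / q) + (1 / (4 * ε) + |(a:ℝ)|)) - |(a:ℝ)|) := by gcongr
    _ = _ := by field_simp; ring

lemma exists_r {α : Type*} [DecidableEq α] [Fintype α] (k : ℕ) (η : ℝ) (hη : 0 < η) :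
    ∃ r : ℕ, ((Finset.univ.filter (fun x : Fin r → α => ∃ c c', c ≠ c' ∧
      |DD c c' x| ≤ 2 * k)).card : ℝ) ≤ η * (Fintype.card α : ℝ) ^ r := by
  classical
  by_contra! hcon
  set q : ℝ := (Fintype.card α : ℝ) with hq
  set T : Finset ((α × α) × ℤ) :=
    (Finset.univ.filter (fun p : α × α => p.1 ≠ p.2)) ×ˢ Finset.Icc (-(2 * k : ℤ)) (2 * k) with hT
  set M : ℝ := T.card + 1 with hM
  have hM0 : 0 < M := by positivity
  have hTn : ∀ p ∈ T, p.1.1 ≠ p.1.2 := by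
    intro p hp
    simp only [hT, Finset.mem_product, Finset.mem_filter] at hp
    exact hp.1.2
  have hq0 : ∀ r, 0 < q ^ r := by
    intro r
    have h1 := hcon r
    have h2 : ((Finset.univ.filter (fun x : Fin r → α => ∃ c c', c ≠ c' ∧
      |DD c c' x| ≤ 2 * k)).card : ℝ) ≤ q ^ r := by
      have := Finset.card_le_univ (Finset.univ.filter (fun x : Fin r → α => ∃ c c', c ≠ c' ∧
      |DD c c' x| ≤ 2 * k))
      rw [Fintype.card_fun, Fintype.card_fin] at this
      rw [hq]; exact_mod_cast this
    have h3 : 0 ≤ q ^ r := by positivity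
    rcases h3.eq_or_lt with h | h
    · rw [← h] at h1 h2; linarith
    · exact h
  have hC : ∀ p : (α × α) × ℤ, ∃ C : ℝ, p ∈ T → ∀ R : ℕ, ∑ r ∈ Finset.range R,
      ((Finset.univ.filter (fun x : Fin r → α => DD p.1.1 p.1.2 x = p.2)).card : ℝ) / q ^ r
      ≤ η / (2 * M) * R + C := by
    intro p
    by_cases hp : p ∈ T
    · obtain ⟨C, hC⟩ := anti p.1.1 p.1.2 (hTn p hp) p.2 (η / (2 * M)) (by positivity)
      exact ⟨C, fun _ => hC⟩
    · exact ⟨0, fun h => absurd h hp⟩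
  choose C hC using hC
  have hb : ∀ r : ℕ, η ≤ ∑ p ∈ T,
      ((Finset.univ.filter (fun x : Fin r → α => DD p.1.1 p.1.2 x = p.2)).card : ℝ) / q ^ r := by
    intro r
    rw [← Finset.sum_div, le_div_iff₀ (hq0 r)]
    refine (hcon r).le.trans ?_
    have hsub : (Finset.univ.filter (fun x : Fin r → α => ∃ c c', c ≠ c' ∧
      |DD c c' x| ≤ 2 * k)) ⊆ T.biUnion (fun p =>
        Finset.univ.filter (fun x : Fin r → α => DD p.1.1 p.1.2 x = p.2)) := by
      intro x hx
      obtain ⟨c, c', hcc, h⟩ := (Finset.mem_filter.1 hx).2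
      refine Finset.mem_biUnion.2 ⟨((c, c'), DD c c' x), ?_, by simp⟩
      simp only [hT, Finset.mem_product, Finset.mem_filter, Finset.mem_univ, true_and,
        Finset.mem_Icc]
      exact ⟨hcc, abs_le.1 h⟩
    have := (Finset.card_le_card hsub).trans Finset.card_biUnion_le
    exact_mod_cast this
  have hfin : ∀ R : ℕ, η * R ≤ η / 2 * R + ∑ p ∈ T, C p := by
    intro R
    calc η * R = ∑ r ∈ Finset.range R, η := by simp [mul_comm]
      _ ≤ ∑ r ∈ Finset.range R, ∑ p ∈ T,
      ((Finset.univ.filter (fun x : Fin r → α => DD p.1.1 p.1.2 x = p.2)).card : ℝ) / q ^ r :=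
        Finset.sum_le_sum fun r _ => hb r
      _ = ∑ p ∈ T, ∑ r ∈ Finset.range R,
      ((Finset.univ.filter (fun x : Fin r → α => DD p.1.1 p.1.2 x = p.2)).card : ℝ) / q ^ r :=
        Finset.sum_comm
      _ ≤ ∑ p ∈ T, (η / (2 * M) * R + C p) := Finset.sum_le_sum fun p hp => hC p hp R
      _ = T.card * (η / (2 * M) * R) + ∑ p ∈ T, C p := by
        rw [Finset.sum_add_distrib]; simp
      _ ≤ M * (η / (2 * M) * R) + ∑ p ∈ T, C p := by
        gcongr; simp [hM]
      _ = _ := by field_simp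
  obtain ⟨R, hR⟩ := exists_nat_gt ((∑ p ∈ T, C p) / (η / 2))
  rw [div_lt_iff₀ (by positivity)] at hR
  have := hfin R
  linarith

def cnt {α : Type*} [DecidableEq α] {r : ℕ} (x : Fin r → α) (c : α) : ℕ :=
  (Finset.univ.filter (fun i => x i = c)).card

lemma DD_eq {α : Type*} [DecidableEq α] {r : ℕ} (x : Fin r → α) (c c' : α) :
    DD c c' x = cnt x c - cnt x c' := by
  unfold DD xi cnt
  rw [Finset.sum_sub_distrib]
  simp

def Win {α : Type*} [DecidableEq α] {r : ℕ} (k : ℕ) (c : α) (x : Fin r → α) : Prop :=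
  ∀ c', c' ≠ c → cnt x c' + 2 * k < cnt x c

lemma win_robust {N r : ℕ} (k : ℕ) (x x' : Fin r → ZMod N) (d c c' : ZMod N)
    (I : Finset (Fin r)) (hI : ∀ i ∈ I, x' i = x i + d) (hr : r ≤ I.card + k)
    (h : Win k c x) (h' : Win k c' x') : c' = c + d := by
  classical
  by_contra hne
  have hcomp : (Finset.univ \ I).card ≤ k := by
    rw [Finset.card_sdiff_of_subset (Finset.subset_univ _)]
    simp; omega
  have h1 : ∀ c, cnt x c ≤ cnt x' (c + d) + k := by
    intro c
    unfold cnt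
    have : (Finset.univ.filter (fun i => x i = c)) ⊆
        (Finset.univ.filter (fun i => x' i = c + d)) ∪ (Finset.univ \ I) := by
      intro i hi
      by_cases hiI : i ∈ I
      · apply Finset.mem_union_left
        simp only [Finset.mem_filter, Finset.mem_univ, true_and] at hi ⊢
        rw [hI i hiI, hi]
      · apply Finset.mem_union_right; simpa using hiI
    have := (Finset.card_le_card this).trans (Finset.card_union_le _ _)
    omega
  have h2 : ∀ c, cnt x' (c + d) ≤ cnt x c + k := by
    intro c
    unfold cnt
    have : (Finset.univ.filter (fun i => x' i = c + d)) ⊆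
        (Finset.univ.filter (fun i => x i = c)) ∪ (Finset.univ \ I) := by
      intro i hi
      by_cases hiI : i ∈ I
      · apply Finset.mem_union_left
        simp only [Finset.mem_filter, Finset.mem_univ, true_and] at hi ⊢
        rw [hI i hiI] at hi
        exact add_right_cancel hi
      · apply Finset.mem_union_right; simpa using hiI
    have := (Finset.card_le_card this).trans (Finset.card_union_le _ _)
    omega
  have a1 := h (c' - d) (fun e => hne (by rw [← e]; ring))
  have a2 := h' (c + d) (fun e => hne e.symm)
  have a3 := h1 c
  have a4 := h2 (c' - d)
  rw [sub_add_cancel] at a4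
  omega

open Classical in
lemma exists_vote {N : ℕ} [NeZero N] (A : Finset (ZMod N)) (δ : ℝ) (hδ : 0 ≤ δ)
    (hA : δ * N < A.card) (k : ℕ) :
    ∃ r : ℕ, δ * (N:ℝ) ^ r <
      (Finset.univ.filter (fun x : Fin r → ZMod N => ∃ c ∈ A, Win k c x)).card := by
  have hN : (0:ℝ) < N := by exact_mod_cast Nat.pos_of_ne_zero (NeZero.ne N)
  have hA0 : (0:ℝ) < A.card := lt_of_le_of_lt (by positivity) hA
  set η : ℝ := (A.card - δ * N) / (2 * A.card) with hη
  have hη0 : 0 < η := div_pos (by linarith) (by positivity)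
  obtain ⟨r, hr⟩ := exists_r (α := ZMod N) k η hη0
  refine ⟨r, ?_⟩
  rw [ZMod.card] at hr
  set w : ℕ := (Finset.univ.filter (fun x : Fin r → ZMod N => Win k 0 x)).card with hw
  have hwc : ∀ c, (Finset.univ.filter (fun x : Fin r → ZMod N => Win k c x)).card = w := by
    intro c
    rw [hw]
    have hcnt : ∀ (x : Fin r → ZMod N) (d : ZMod N), cnt (fun i => x i - c) d = cnt x (d + c) := by
      intro x d
      simp only [cnt, sub_eq_iff_eq_add]
    refine Finset.card_bij' (fun x _ => fun i => x i - c) (fun x _ => fun i => x i + c) ?_ ?_ ?_ ?_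
    · intro x hx
      replace hx := (Finset.mem_filter.1 hx).2
      refine Finset.mem_filter.2 ⟨Finset.mem_univ _, ?_⟩
      intro d hd
      rw [hcnt, hcnt, zero_add]
      exact hx _ (fun e => hd (by simpa using e))
    · intro x hx
      replace hx := (Finset.mem_filter.1 hx).2
      refine Finset.mem_filter.2 ⟨Finset.mem_univ _, ?_⟩
      intro d hd
      have h1 := hcnt (fun i => x i + c) (d - c)
      have h2 := hcnt (fun i => x i + c) 0
      simp only [add_sub_cancel_right, sub_add_cancel, zero_add] at h1 h2
      rw [← h1, ← h2]
      exact hx _ (fun e => hd (sub_eq_zero.1 e))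
    · intro x _; simp
    · intro x _; simp
  have hdisj : ∀ c c' : ZMod N, c ≠ c' → ∀ x : Fin r → ZMod N, Win k c x → ¬ Win k c' x := by
    intro c c' hcc x h h'
    have := h c' hcc.symm
    have := h' c hcc
    omega
  have hAw : (Finset.univ.filter (fun x : Fin r → ZMod N => ∃ c ∈ A, Win k c x)).card = A.card * w := by
    have : (Finset.univ.filter (fun x : Fin r → ZMod N => ∃ c ∈ A, Win k c x)) =
        A.biUnion (fun c => Finset.univ.filter (fun x : Fin r → ZMod N => Win k c x)) := by
      ext x; simp
    rw [this, Finset.card_biUnion]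
    · simp [hwc]
    · intro c _ c' _ hcc
      rw [Function.onFun, Finset.disjoint_left]
      intro x hx hx'
      exact hdisj c c' hcc x (by simpa using hx) (by simpa using hx')
  have hcover : (N:ℝ) ^ r ≤ N * w + η * (N:ℝ) ^ r := by
    have hsub : (Finset.univ : Finset (Fin r → ZMod N)) ⊆
        (Finset.univ.biUnion (fun c => Finset.univ.filter (fun x : Fin r → ZMod N => Win k c x))) ∪
        (Finset.univ.filter (fun x : Fin r → ZMod N => ∃ c c', c ≠ c' ∧ |DD c c' x| ≤ 2 * k)) := by
      intro x _
      obtain ⟨c, -, hc⟩ := Finset.exists_max_image Finset.univ (cnt x) ⟨(0 : ZMod N), Finset.mem_univ _⟩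
      by_cases h : Win k c x
      · exact Finset.mem_union_left _ (Finset.mem_biUnion.2 ⟨c, Finset.mem_univ _, by simpa using h⟩)
      · apply Finset.mem_union_right
        unfold Win at h
        push Not at h
        obtain ⟨c', hne, hle⟩ := h
        have hm := hc c' (Finset.mem_univ _)
        simp only [Finset.mem_filter, Finset.mem_univ, true_and]
        refine ⟨c, c', hne.symm, ?_⟩
        rw [DD_eq, abs_le]
        constructor <;> omega
    have h1 := (Finset.card_le_card hsub).trans (Finset.card_union_le _ _)
    have h2 : (Finset.univ.biUnion (fun c => Finset.univ.filter
        (fun x : Fin r → ZMod N => Win k c x))).card ≤ N * w := by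
      refine Finset.card_biUnion_le.trans ?_
      simp [hwc]
    rw [Finset.card_univ, Fintype.card_fun, Fintype.card_fin, ZMod.card] at h1
    have h3 := h1.trans (Nat.add_le_add_right h2 _)
    have h4 : (N:ℝ) ^ r ≤ N * w + ((Finset.univ.filter (fun x : Fin r → ZMod N =>
        ∃ c c', c ≠ c' ∧ |DD c c' x| ≤ 2 * k)).card : ℝ) := by exact_mod_cast h3
    linarith
  rw [hAw]
  push_cast
  have hNr : (0:ℝ) < (N:ℝ) ^ r := by positivity
  have h5 : A.card * ((1 - η) * (N:ℝ) ^ r) ≤ A.card * (N * w) :=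
    mul_le_mul_of_nonneg_left (by linarith : (1-η)*(N:ℝ)^r ≤ N*w) hA0.le
  have h6 : A.card * (1 - η) = (A.card + δ * N) / 2 := by
    rw [hη]; field_simp; ring
  have h7 : δ * N * (N:ℝ)^r < A.card * (1 - η) * (N:ℝ) ^ r := by
    rw [h6]; gcongr; linarith
  have h8 : N * (δ * (N:ℝ)^r) < N * (A.card * w) := by nlinarith
  exact lt_of_mul_lt_mul_left h8 hN.le

def PP (δ : ℝ) (E : Finset ℤ) : Prop :=
  ∃ N : ℕ, 0 < N ∧ ∃ A : Finset (ZMod N), δ * N < A.card ∧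
    ∀ e ∈ E, ∀ a ∈ A, a + (e : ZMod N) ∉ A

lemma avg {M r : ℕ} [NeZero M] (A' : Finset (Fin r → ZMod M)) (δ : ℝ)
    (hA : δ * (M:ℝ) ^ r < A'.card) (b : Fin r → ℤ) (E : Finset ℤ)
    (h : ∀ n ∈ E, ∀ z ∈ A', (fun i => z i + ((n * b i : ℤ) : ZMod M)) ∉ A') : PP δ E := by
  classical
  have hM : (0:ℝ) < M := by exact_mod_cast Nat.pos_of_ne_zero (NeZero.ne M)
  set B : (Fin r → ZMod M) → Finset (ZMod M) := fun t =>
    Finset.univ.filter (fun u => (fun i => t i + u * (b i : ZMod M)) ∈ A') with hB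
  have hsum : ∑ t, (B t).card = M * A'.card := by
    simp only [hB, Finset.card_filter]
    rw [Finset.sum_comm]
    have : ∀ u : ZMod M, ∑ t : Fin r → ZMod M,
        (if (fun i => t i + u * (b i : ZMod M)) ∈ A' then 1 else 0) = A'.card := by
      intro u
      rw [Fintype.sum_equiv (Equiv.addRight (fun i => u * (b i : ZMod M)))
        (fun t => if (fun i => t i + u * (b i : ZMod M)) ∈ A' then 1 else 0)
        (fun t => if t ∈ A' then 1 else 0) (fun t => rfl)]
      simp
    rw [Finset.sum_congr rfl (fun u _ => this u)]
    simp
  have : ∃ t, δ * M < (B t).card := by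
    by_contra! hcon
    have h1 : ((∑ t, (B t).card : ℕ) : ℝ) ≤ ∑ t : Fin r → ZMod M, δ * M := by
      push_cast; exact Finset.sum_le_sum fun t _ => hcon t
    rw [hsum] at h1
    simp only [Finset.sum_const, Finset.card_univ, Fintype.card_fun, Fintype.card_fin, ZMod.card,
      nsmul_eq_mul] at h1
    push_cast at h1
    have h2 : M * (δ * (M:ℝ) ^ r) < M * A'.card := by gcongr
    linarith
  obtain ⟨t, ht⟩ := this
  refine ⟨M, Nat.pos_of_ne_zero (NeZero.ne M), B t, ht, fun e he a ha ha' => ?_⟩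
  have h1 := (Finset.mem_filter.1 ha).2
  have h2 := (Finset.mem_filter.1 ha').2
  refine h e he _ h1 ?_
  convert h2 using 2
  push_cast; ring

def rho (N L : ℕ) {M : ℕ} (z : ZMod M) : ZMod N := ((z.val / L : ℕ) : ZMod N)

lemma rho_step {N L M : ℕ} [NeZero M] (hL : 0 < L) (hM : M = N * L) (z : ZMod M) (w d s j : ℤ) (h : ℕ)
    (hw : w = d * L + s + M * j) (hs : |s| ≤ h) (h1 : h ≤ z.val % L) (h2 : z.val % L + h < L) :
    rho N L (z + (w : ZMod M)) = rho N L z + (d : ZMod N) := by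
  have e1 : (((z + (w : ZMod M)).val : ℕ) : ℤ) = ((z.val : ℤ) + w) % M := by
    rw [← ZMod.val_intCast]
    congr 2
    push_cast
    rw [ZMod.natCast_zmod_val]
  have e2 := Int.emod_add_mul_ediv ((z.val : ℤ) + w) M
  set t := ((z.val : ℤ) + w) / M
  have e3 : (z.val : ℤ) = L * (z.val / L : ℕ) + (z.val % L : ℕ) := by
    exact_mod_cast (Nat.div_add_mod _ _).symm
  set a : ℕ := z.val / L
  set c : ℕ := z.val % L
  have hMc : (M : ℤ) = N * L := by exact_mod_cast hM
  have e4 : (((z + (w : ZMod M)).val : ℕ) : ℤ) = (c + s) + L * (a + d + N * (j - t)) := by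
    rw [e1]
    have : ((z.val : ℤ) + w) % M = z.val + w - M * t := by linarith
    rw [this, e3, hw, hMc]; ring
  have hs' := abs_le.1 hs
  have e5 : (((z + (w : ZMod M)).val / L : ℕ) : ℤ) = a + d + N * (j - t) := by
    rw [Int.natCast_div, e4, Int.add_mul_ediv_left _ _ (by omega), Int.ediv_eq_zero_of_lt (by omega) (by omega)]
    ring
  unfold rho
  have := congrArg (Int.cast : ℤ → ZMod N) e5
  rw [Int.cast_natCast, Int.cast_add, Int.cast_add, Int.cast_mul, Int.cast_natCast,
    Int.cast_natCast, ZMod.natCast_self, zero_mul, add_zero] at this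
  exact this

open Classical in
lemma count {N L M r h : ℕ} [NeZero N] [NeZero M] (hL : 0 < L) (hM : M = N * L) (hh : 2 * h ≤ L)
    (W : Finset (Fin r → ZMod N)) :
    (L - 2 * h) ^ r * W.card ≤ (Finset.univ.filter (fun z : Fin r → ZMod M =>
      (∀ i, h ≤ (z i).val % L ∧ (z i).val % L + h < L) ∧ (fun i => rho N L (z i)) ∈ W)).card := by
  have hc : (W ×ˢ (Finset.univ : Finset (Fin r → Fin (L - 2 * h)))).card = (L - 2 * h) ^ r * W.card := by
    rw [Finset.card_product]; simp [mul_comm]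
  rw [← hc]
  have hv : ∀ (x : ZMod N) (t : Fin (L - 2 * h)),
      ((x.val * L + h + t : ℕ) : ZMod M).val = x.val * L + (h + t) := by
    intro x t
    rw [ZMod.val_natCast, Nat.mod_eq_of_lt, add_assoc]
    have := ZMod.val_lt x
    have := t.2
    rw [hM]
    calc x.val * L + h + t < (x.val + 1) * L := by rw [add_mul]; omega
      _ ≤ N * L := Nat.mul_le_mul_right _ (by omega)
  have hv1 : ∀ (x : ZMod N) (t : Fin (L - 2 * h)),
      ((x.val * L + h + t : ℕ) : ZMod M).val % L = h + t := by
    intro x t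
    have := t.2
    rw [hv, Nat.mul_add_mod', Nat.mod_eq_of_lt]
    omega
  have hv2 : ∀ (x : ZMod N) (t : Fin (L - 2 * h)),
      ((x.val * L + h + t : ℕ) : ZMod M).val / L = x.val := by
    intro x t
    have := t.2
    rw [hv, add_comm, Nat.add_mul_div_right _ _ hL, Nat.div_eq_of_lt (by omega), zero_add]
  refine Finset.card_le_card_of_injOn
    (fun p => fun i => (((p.1 i).val * L + h + p.2 i : ℕ) : ZMod M)) ?_ ?_
  · intro p hp
    have hp1 := (Finset.mem_product.1 hp).1
    refine Finset.mem_filter.2 ⟨Finset.mem_univ _, fun i => ?_, ?_⟩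
    · simp only [hv1]
      have := (p.2 i).2
      omega
    · convert hp1 using 2 with i
      unfold rho
      rw [hv2, ZMod.natCast_zmod_val]
  · intro p _ p' _ hpp
    have hi := fun i => congrFun hpp i
    ext i
    · have := congrArg (fun z : ZMod M => z.val / L) (hi i)
      simp only [hv2] at this
      exact ZMod.val_injective _ this
    · have := congrArg (fun z : ZMod M => z.val % L) (hi i)
      simp only [hv1] at this
      omega

lemma exists_q (r : ℕ) (a b : ℝ) (hab : a < b) :
    ∃ q : ℕ, 3 ≤ q ∧ a * (q:ℝ) ^ r < ((q - 2 : ℕ) : ℝ) ^ r * b := by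
  have h1 : Tendsto (fun q : ℕ => (1 - 2 / (q:ℝ)) ^ r * b) atTop (nhds ((1 - 0) ^ r * b)) :=
    ((tendsto_const_nhds.sub (tendsto_const_div_atTop_nhds_zero_nat 2)).pow r).mul_const b
  rw [sub_zero, one_pow, one_mul] at h1
  obtain ⟨q, hq, hq3⟩ := ((h1.eventually (lt_mem_nhds hab)).and (eventually_ge_atTop 3)).exists
  refine ⟨q, hq3, ?_⟩
  have hq0 : (0:ℝ) < q := by exact_mod_cast (by omega : 0 < q)
  have e : ((q - 2 : ℕ) : ℝ) = (1 - 2 / (q:ℝ)) * q := by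
    rw [Nat.cast_sub (by omega)]; push_cast; field_simp
  rw [e, mul_pow]
  have : a * (q:ℝ) ^ r < ((1 - 2 / (q:ℝ)) ^ r * b) * (q:ℝ) ^ r := by gcongr
  linarith

lemma bound1 (n : ℤ) (β M Nr L q h γ : ℝ) (b : ℤ) (hb : |(b:ℝ) - β * M| ≤ 1 / 2) (hN : 0 < Nr)
    (hL : L = q * h) (hM : M = Nr * L) (hq : 0 < q) (hh : 0 < h) (hβ : |β - 1 / Nr| ≤ γ)
    (hnh : |(n:ℝ)| ≤ h) (hg : |(n:ℝ)| * γ * Nr * q ≤ 1 / 2) :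
    |(n:ℝ) * b - n * L| ≤ h := by
  have hM0 : 0 < M := by rw [hM, hL]; positivity
  have e : (n:ℝ) * b - n * L = n * (b - β * M) + n * ((β - 1 / Nr) * M) := by
    rw [hM]; field_simp; ring
  rw [e]
  refine (abs_add_le _ _).trans ?_
  rw [abs_mul, abs_mul, abs_mul, abs_of_pos hM0]
  have h1 : |(n:ℝ)| * |(b:ℝ) - β * M| ≤ h * (1 / 2) := by gcongr
  have h2 : |(n:ℝ)| * (|β - 1 / Nr| * M) ≤ |(n:ℝ)| * (γ * M) := by gcongr
  have h3 : |(n:ℝ)| * (γ * M) = (|(n:ℝ)| * γ * Nr * q) * h := by rw [hM, hL]; ring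
  have h4 : (|(n:ℝ)| * γ * Nr * q) * h ≤ 1 / 2 * h := by gcongr
  linarith

lemma bound2 (n : ℤ) (β M Nr L q h ε : ℝ) (b : ℤ) (hb : |(b:ℝ) - β * M| ≤ 1 / 2) (hN : 0 < Nr)
    (hL : L = q * h) (hM : M = Nr * L) (hq : 0 < q) (hh : 0 < h)
    (hβ : ‖n • (β : TT) - ((1 / Nr : ℝ) : TT)‖ < ε)
    (hnh : |(n:ℝ)| ≤ h) (hg : ε * Nr * q ≤ 1 / 2) :
    ∃ j : ℤ, |(n:ℝ) * b - (L + M * j)| ≤ h := by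
  have hM0 : 0 < M := by rw [hM, hL]; positivity
  rw [← AddCircle.coe_zsmul, ← AddCircle.coe_sub, AddCircle.norm_eq] at hβ
  simp only [inv_one, one_mul, mul_one, zsmul_eq_mul] at hβ
  set j := round (n * β - 1 / Nr)
  refine ⟨j, ?_⟩
  have e : (n:ℝ) * b - (L + M * j) = n * (b - β * M) + (n * β - 1 / Nr - j) * M := by
    rw [hM]; field_simp; ring
  rw [e]
  refine (abs_add_le _ _).trans ?_
  rw [abs_mul, abs_mul, abs_of_pos hM0]
  have h1 : |(n:ℝ)| * |(b:ℝ) - β * M| ≤ h * (1 / 2) := by gcongr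
  have h2 : |(n * β - 1 / Nr - j)| * M ≤ ε * M := by gcongr
  have h3 : ε * M = (ε * Nr * q) * h := by rw [hM, hL]; ring
  have h4 : (ε * Nr * q) * h ≤ 1 / 2 * h := by gcongr
  linarith

lemma exists_bound (E : Finset ℤ) : ∃ H : ℕ, 1 ≤ H ∧ ∀ n ∈ E, |(n:ℝ)| ≤ H := by
  refine ⟨1 + ∑ n ∈ E, n.natAbs, by omega, fun n hn => ?_⟩
  have : n.natAbs ≤ ∑ n ∈ E, n.natAbs :=
    Finset.single_le_sum (f := fun n : ℤ => n.natAbs) (fun _ _ => Nat.zero_le _) hn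
  have h2 : |(n:ℝ)| = ((n.natAbs : ℕ) : ℝ) := by
    rw [Nat.cast_natAbs, Int.cast_abs]
  rw [h2]
  exact_mod_cast (by omega)

lemma stage {S : Set ℤ} (hS : BohrDense S) (δ : ℝ) (hδ : 0 ≤ δ) (E : Finset ℤ) (hE1 : 1 ∈ E)
    (hE : PP δ E) (m : ℤ) (k : ℕ) (ε₁ : ℝ) (hε₁ : 0 < ε₁) :
    ∃ E₂ : Finset ℤ, (∀ n ∈ E₂, n ∈ S) ∧
      (∀ θ : Fin k → TT, ∃ n ∈ E₂, ∀ j, ‖n • θ j - m • θ j‖ < ε₁) ∧ PP δ (E ∪ E₂) := by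
  classical
  obtain ⟨N, hN, A, hA, hAE⟩ := hE
  haveI : NeZero N := ⟨hN.ne'⟩
  have hNr : (0:ℝ) < N := by exact_mod_cast hN
  obtain ⟨r, hr⟩ := exists_vote A δ hδ hA k
  set W := Finset.univ.filter (fun x : Fin r → ZMod N => ∃ c ∈ A, Win k c x) with hW
  obtain ⟨q, hq3, hq⟩ := exists_q r _ _ hr
  have hq0 : (0:ℝ) < q := by exact_mod_cast (by omega : 0 < q)
  obtain ⟨H₁, hH₁, hEH₁⟩ := exists_bound E
  have hH₁r : (0:ℝ) < H₁ := by exact_mod_cast hH₁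
  set ε₂ : ℝ := 1 / (2 * N * q) with hε₂
  have hε₂0 : 0 < ε₂ := by positivity
  set γ : ℝ := 1 / (2 * H₁ * N * q) with hγ
  have hγ0 : 0 < γ := by positivity
  obtain ⟨β, hβ, hβN⟩ := exists_beta r N γ hγ0
  obtain ⟨E₂, hE₂S, hE₂θ, hE₂I⟩ := exists_finite_S (k := k) hS β hβ m (1 / N) ε₁ ε₂ hε₁ hε₂0
  refine ⟨E₂, hE₂S, hE₂θ, ?_⟩
  obtain ⟨h, hh, hEh⟩ := exists_bound (E ∪ E₂)
  have hh0 : (0:ℝ) < h := by exact_mod_cast hh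
  set L := q * h with hL
  set M := N * L with hM
  have hL0 : 0 < L := Nat.mul_pos (by omega) hh
  have hM0 : 0 < M := Nat.mul_pos hN hL0
  haveI : NeZero M := ⟨hM0.ne'⟩
  have hLr : (L:ℝ) = q * h := by rw [hL]; push_cast; ring
  have hMr : (M:ℝ) = N * L := by rw [hM]; push_cast; ring
  have h2h : 2 * h ≤ L := Nat.mul_le_mul_right _ (by omega)
  set b : Fin r → ℤ := fun i => round (β i * M) with hb
  have hb' : ∀ i, |(b i : ℝ) - β i * M| ≤ 1 / 2 := fun i => by
    rw [abs_sub_comm]; exact abs_sub_round _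
  have hcount := count (M := M) (h := h) hL0 hM h2h W
  refine avg _ δ (lt_of_lt_of_le ?_ (Nat.cast_le.2 hcount)) b (E ∪ E₂) ?_
  · have e : L - 2 * h = (q - 2) * h := by rw [hL, Nat.sub_mul]
    rw [e]
    push_cast [hMr, hLr]
    have : δ * (N:ℝ) ^ r * (q:ℝ) ^ r * (h:ℝ) ^ r < ((q - 2 : ℕ) : ℝ) ^ r * W.card * (h:ℝ) ^ r := by
      gcongr
    calc δ * ((N:ℝ) * (q * h)) ^ r = δ * (N:ℝ) ^ r * (q:ℝ) ^ r * (h:ℝ) ^ r := by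
          rw [mul_pow, mul_pow]; ring
      _ < _ := this
      _ = _ := by rw [mul_pow]; ring
  · intro n hn z hz hz'
    obtain ⟨hz1, hz2⟩ := (Finset.mem_filter.1 hz).2
    obtain ⟨_, hz3⟩ := (Finset.mem_filter.1 hz').2
    obtain ⟨c, hc, hcw⟩ := (Finset.mem_filter.1 hz2).2
    obtain ⟨c', hc', hcw'⟩ := (Finset.mem_filter.1 hz3).2
    have key : ∃ d ∈ E, ∃ I : Finset (Fin r), r ≤ I.card + k ∧ ∀ i ∈ I, ∃ j : ℤ,
        |(n:ℝ) * b i - (d * L + M * j)| ≤ h := by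
      rcases Finset.mem_union.1 hn with hnE | hnE
      · refine ⟨n, hnE, Finset.univ, by simp, fun i _ => ⟨0, ?_⟩⟩
        have := bound1 n (β i) M N L q h γ (b i) (hb' i) hNr hLr hMr hq0 hh0 (hβN i) (hEh n hn) (by
          have h1 := hEH₁ n hnE
          calc |(n:ℝ)| * γ * N * q ≤ H₁ * γ * N * q := by gcongr
            _ = 1 / 2 := by rw [hγ]; field_simp
            _ ≤ _ := le_rfl)
        simpa using this
      · obtain ⟨I, hI, hIr⟩ := hE₂I n hnE
        refine ⟨1, hE1, I, hIr, fun i hi => ?_⟩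
        have := bound2 n (β i) M N L q h ε₂ (b i) (hb' i) hNr hLr hMr hq0 hh0 (hI i hi) (hEh n hn) (by
          rw [hε₂]; apply le_of_eq; field_simp)
        simpa using this
    obtain ⟨d, hd, I, hIr, hI⟩ := key
    have hcd := win_robust k _ _ (d : ZMod N) c c' I (fun i hi => ?_) hIr hcw hcw'
    · exact hAE d hd c hc (hcd ▸ hc')
    · obtain ⟨j, hj⟩ := hI i hi
      refine rho_step hL0 hM (z i) (n * b i) d (n * b i - (d * L + M * j)) j h (by ring) ?_
        (hz1 i).1 (hz1 i).2
      exact_mod_cast hj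

open Classical in
lemma card_count (B : Set ℤ) (n : ℕ) :
    Nat.card ↥(B ∩ Set.Ioc 0 (0 + (n:ℤ))) = Nat.count (fun i : ℕ => (i:ℤ) + 1 ∈ B) n := by
  have e : B ∩ Set.Ioc 0 (0 + (n:ℤ)) =
      (((Finset.range n).filter (fun i : ℕ => (i:ℤ) + 1 ∈ B)).image (fun i : ℕ => (i:ℤ) + 1) : Finset ℤ) := by
    ext x
    simp only [Finset.coe_image, Set.mem_image, Finset.coe_filter, Finset.mem_range,
      Set.mem_inter_iff, Set.mem_Ioc, Set.mem_setOf_eq]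
    constructor
    · rintro ⟨h1, h2, h3⟩
      have hx : ((x - 1).toNat : ℤ) + 1 = x := by omega
      exact ⟨(x - 1).toNat, ⟨by omega, by rw [hx]; exact h1⟩, hx⟩
    · rintro ⟨i, ⟨h1, h2⟩, rfl⟩
      exact ⟨h2, by omega, by omega⟩
  rw [e, Nat.card_coe_set_eq, Set.ncard_coe_finset, Finset.card_image_of_injective, Nat.count_eq_card_filter_range]
  intro a b h
  simpa using h

open Classical in
lemma exists_walk (δ : ℝ) (E : Finset ℤ) (hE : PP δ E) :
    ∃ B : Set ℤ, (∀ n : ℕ, δ * n ≤ Nat.count (fun i : ℕ => (i:ℤ) + 1 ∈ B) n) ∧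
      ∀ e ∈ E, ∀ a ∈ B, a + e ∉ B := by
  obtain ⟨N, hN, A, hA, hAE⟩ := hE
  haveI : NeZero N := ⟨hN.ne'⟩
  set p : ℕ → Prop := fun x => (x : ZMod N) ∈ A with hp
  have hper : ∀ n, Nat.count (fun i => p (n + i)) N = A.card := by
    intro n
    rw [Nat.count_eq_card_filter_range]
    refine Finset.card_bij' (fun i _ => ((n + i : ℕ) : ZMod N)) (fun a _ => (a - n : ZMod N).val) ?_ ?_ ?_ ?_
    · intro i hi; exact (Finset.mem_filter.1 hi).2
    · intro a ha
      refine Finset.mem_filter.2 ⟨Finset.mem_range.2 (ZMod.val_lt _), ?_⟩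
      simpa [hp] using ha
    · intro i hi
      have := Finset.mem_range.1 (Finset.mem_filter.1 hi).1
      push_cast
      rw [add_sub_cancel_left, ZMod.val_natCast, Nat.mod_eq_of_lt this]
    · intro a ha
      simp
  set g : ℕ → ℝ := fun n => Nat.count p n - δ * n with hg
  have hgN : ∀ n, g n ≤ g (n + N) := by
    intro n
    simp only [hg]
    rw [Nat.count_add, hper]
    push_cast
    nlinarith
  obtain ⟨t, -, ht⟩ := Finset.exists_min_image (Finset.range N) g ⟨0, Finset.mem_range.2 hN⟩
  have ht' : ∀ n, g t ≤ g n := by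
    intro n
    induction n using Nat.strong_induction_on with
    | _ n ih =>
      by_cases h : n < N
      · exact ht n (Finset.mem_range.2 h)
      · have h1 := ih (n - N) (by omega)
        have h2 := hgN (n - N)
        rw [Nat.sub_add_cancel (by omega)] at h2
        exact h1.trans h2
  refine ⟨{x | ((t + x - 1 : ℤ) : ZMod N) ∈ A}, fun n => ?_, fun e he a ha ha' => ?_⟩
  · have h1 := ht' (t + n)
    simp only [hg, Nat.count_add] at h1
    have e : (fun i : ℕ => (i:ℤ) + 1 ∈ {x : ℤ | ((t + x - 1 : ℤ) : ZMod N) ∈ A}) = fun i => p (t + i) := by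
      funext i
      simp only [hp, Set.mem_setOf_eq]
      push_cast
      congr 1
      ring_nf
    refine le_trans (b := (Nat.count (fun i => p (t + i)) n : ℝ)) ?_ (le_of_eq (congrArg _ ?_))
    · push_cast at h1
      linarith
    · symm
      simp only [Nat.count_eq_card_filter_range]
      congr 1
      ext i
      simp only [Finset.mem_filter]
      rw [← congrFun e i]
  · refine hAE e he _ ha ?_
    have : ((t + (a + e) - 1 : ℤ) : ZMod N) ∈ A := ha'
    convert this using 1
    push_cast; ring

open Classical in
lemma density_ge (A : Set ℤ) (δ : ℝ)
    (h : ∀ n : ℕ, δ * n ≤ Nat.count (fun i : ℕ => (i:ℤ) + 1 ∈ A) n) : δ ≤ upperBanachDensity A := by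
  have hle : ∀ (n : ℕ) (k : ℤ), (Nat.card ↥(A ∩ Set.Ioc k (k + n)) : ℝ) / n ≤ 1 := by
    intro n k
    apply div_le_one_of_le₀ _ (Nat.cast_nonneg n)
    have h1 : Nat.card ↥(A ∩ Set.Ioc k (k + n)) ≤ n := by
      rw [Nat.card_coe_set_eq]
      refine (Set.ncard_le_ncard Set.inter_subset_right (Set.finite_Ioc _ _)).trans ?_
      rw [← Finset.coe_Ioc, Set.ncard_coe_finset]; simp
    exact_mod_cast h1
  have hbdd : ∀ n : ℕ, BddAbove (Set.range fun k : ℤ => (Nat.card ↥(A ∩ Set.Ioc k (k + n)) : ℝ) / n) :=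
    fun n => ⟨1, by rintro _ ⟨k, rfl⟩; exact hle n k⟩
  unfold upperBanachDensity
  refine le_limsup_of_frequently_le (Eventually.frequently ?_) ?_
  · filter_upwards [eventually_gt_atTop 0] with n hn
    refine le_trans ?_ (le_ciSup (hbdd n) 0)
    rw [le_div_iff₀ (by exact_mod_cast hn), card_count]
    exact h n
  · exact isBoundedUnder_of ⟨1, fun n => ciSup_le (hle n)⟩

lemma bohr_dense_of (S : Set ℤ) (h : ∀ (m : ℤ) (k b : ℕ) (θ : Fin k → TT),
    ∃ n ∈ S, ∀ j, ‖n • θ j - m • θ j‖ < 1 / ((b:ℝ) + 1)) : BohrDense S := by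
  unfold BohrDense
  letI := bohrTopology
  intro m
  rw [mem_closure_iff_nhds]
  intro U hU
  have hn : nhds m = ⨅ φ : ℤ →+ TT, comap φ (nhds (φ m)) := by
    change @nhds ℤ (⨅ φ : ℤ →+ AddCircle (1 : ℝ), TopologicalSpace.induced (⇑φ) inferInstance) m = _
    rw [nhds_iInf]
    congr 1; funext φ
    rw [nhds_induced]
  rw [hn] at hU
  have hb := Filter.HasBasis.iInf' (fun φ : ℤ →+ TT => (Metric.nhds_basis_ball (x := φ m)).comap φ)
  obtain ⟨⟨F, R⟩, ⟨hF, hR⟩, hFU⟩ := hb.mem_iff.1 hU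
  simp only at hF hR hFU
  have hev : ∀ᶠ b : ℕ in atTop, ∀ φ ∈ F, 1 / ((b:ℝ) + 1) < R φ :=
    (Filter.eventually_all_finite hF).2 fun φ hφ =>
      (tendsto_one_div_add_atTop_nhds_zero_nat).eventually (gt_mem_nhds (hR φ hφ))
  obtain ⟨b, hb⟩ := hev.exists
  haveI := hF.to_subtype
  obtain ⟨k, ⟨e⟩⟩ := Finite.exists_equiv_fin F
  obtain ⟨n, hnS, hnn⟩ := h m k b (fun j => (e.symm j : ℤ →+ TT) 1)
  refine ⟨n, hFU ?_, hnS⟩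
  simp only [Set.mem_iInter, Set.mem_preimage, Metric.mem_ball]
  intro φ hφ
  have := hnn (e ⟨φ, hφ⟩)
  simp only [Equiv.symm_apply_apply] at this
  rw [← map_zsmul, ← map_zsmul, zsmul_int_one, zsmul_int_one, ← dist_eq_norm] at this
  exact this.trans (hb φ hφ)

theorem stmt1 (S : Set ℤ) (hS : BohrDense S) (δ : ℝ) (hδ0 : 0 ≤ δ) (hδ : δ < 1 / 2) :
    ∃ S' : Set ℤ, S' ⊆ S ∧ BohrDense S' ∧ Nonrecurrent δ S' := by
  classical
  obtain ⟨δ', h1, h2⟩ := exists_between hδ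
  have h0 : 0 ≤ δ' := hδ0.trans h1.le
  have base : PP δ' {1} := by
    refine ⟨2, by norm_num, {0}, ?_, ?_⟩
    · simp; linarith
    · intro e he a ha
      simp only [Finset.mem_singleton] at he ha ⊢
      subst he ha
      decide
  obtain ⟨p, hp⟩ := exists_surjective_nat (ℤ × ℕ × ℕ)
  have hstep : ∀ (j : ℕ) (E : {E : Finset ℤ // 1 ∈ E ∧ PP δ' E}),
      ∃ E' : {E : Finset ℤ // 1 ∈ E ∧ PP δ' E}, E.1 ⊆ E'.1 ∧
        ∀ θ : Fin (p j).2.1 → TT, ∃ n ∈ E'.1, n ∈ S ∧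
          ∀ i, ‖n • θ i - (p j).1 • θ i‖ < 1 / (((p j).2.2 : ℝ) + 1) := by
    rintro j ⟨E, hE1, hE⟩
    obtain ⟨E₂, ha, hb, hc⟩ := stage hS δ' h0 E hE1 hE (p j).1 (p j).2.1
      (1 / (((p j).2.2 : ℝ) + 1)) (by positivity)
    refine ⟨⟨E ∪ E₂, Finset.mem_union_left _ hE1, hc⟩, Finset.subset_union_left, fun θ => ?_⟩
    obtain ⟨n, hn, hn'⟩ := hb θ
    exact ⟨n, Finset.mem_union_right _ hn, ha n hn, hn'⟩
  choose f hf hf' using hstep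
  let EE : ℕ → {E : Finset ℤ // 1 ∈ E ∧ PP δ' E} := fun j =>
    Nat.rec ⟨{1}, Finset.mem_singleton_self _, base⟩ (fun j E => f j E) j
  have hEE : ∀ j, EE (j + 1) = f j (EE j) := fun _ => rfl
  have hmono : Monotone (fun j => (EE j).1) := monotone_nat_of_le_succ fun j => by
    rw [hEE]; exact hf j (EE j)
  choose B hB hB' using fun j => exists_walk δ' (EE j).1 (EE j).2.2
  refine ⟨{n | n ∈ S ∧ ∃ j, n ∈ (EE j).1}, fun n hn => hn.1, ?_, ?_⟩
  · apply bohr_dense_of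
    intro m k b θ
    obtain ⟨j, hj⟩ := hp (m, k, b)
    have := hf' j (EE j)
    rw [hj] at this
    obtain ⟨n, hn, hnS, hn'⟩ := this θ
    exact ⟨n, ⟨hnS, j + 1, hn⟩, hn'⟩
  · refine ⟨{x | ∀ᶠ j in (hyperfilter ℕ : Filter ℕ), x ∈ B j}, h1.trans_le (density_ge _ _ ?_), ?_⟩
    · intro n
      have hev : ∀ᶠ j in (hyperfilter ℕ : Filter ℕ), ∀ i ∈ Finset.range n,
          ((i:ℤ) + 1 ∈ B j ↔ ∀ᶠ j in (hyperfilter ℕ : Filter ℕ), (i:ℤ) + 1 ∈ B j) := by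
        rw [Filter.eventually_all_finset]
        intro i _
        by_cases h : ∀ᶠ j in (hyperfilter ℕ : Filter ℕ), (i:ℤ) + 1 ∈ B j
        · filter_upwards [h] with j hj
          exact ⟨fun _ => h, fun _ => hj⟩
        · filter_upwards [Ultrafilter.eventually_not.2 h] with j hj
          exact ⟨fun h' => absurd h' hj, fun h' => absurd h' h⟩
      obtain ⟨j, hj⟩ := hev.exists
      have := hB j n
      rw [Nat.count_eq_card_filter_range] at this ⊢
      rw [Finset.filter_congr hj] at this
      exact this
    · rw [Set.eq_empty_iff_forall_notMem]
      rintro s ⟨hs, hsS, j₀, hj₀⟩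
      obtain ⟨a, ha, b, hb, rfl⟩ := Set.mem_sub.1 hs
      have hge : ∀ᶠ j in (hyperfilter ℕ : Filter ℕ), j₀ ≤ j :=
        (Nat.hyperfilter_le_atTop) (eventually_ge_atTop j₀)
      obtain ⟨j, ⟨hja, hjb⟩, hjj⟩ := ((Filter.Eventually.and ha hb).and hge).exists
      refine hB' j (a - b) (hmono hjj hj₀) b hjb ?_
      rwa [add_sub_cancel]
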